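/- arXiv:1704.05124 — 6 statements merged into one kernel-verified Lean document; each statement's English description precedes it below -/
import Mathlib

section
/- For every σ-structure A and every positive integer k, the map δ_A : T_k A → T_k T_k A is a homomorphism of σ-structures; moreover δ is natural: for every homomorphism f : A → B one has (T_k T_k f) ∘ δ_A = δ_B ∘ T_k f. -/
/-!
Common definitions: relational signatures, structures, homomorphisms,
the pebbling comonad T_k, positions and strategies, tree decompositions.
-/

/-- A relational signature: a type of relation symbols with arities. -/
structure Signature where
  Rel : Type
  ar : Rel → ℕ

/-- A σ-structure: a carrier together with an interpretation of each relation symbol. -/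
structure Struct (σ : Signature) where
  carrier : Type
  rel : ∀ R : σ.Rel, (Fin (σ.ar R) → carrier) → Prop

/-- Homomorphisms of σ-structures. -/
def IsHom {σ : Signature} (A B : Struct σ) (f : A.carrier → B.carrier) : Prop :=
  ∀ (R : σ.Rel) (t : Fin (σ.ar R) → A.carrier), A.rel R t → B.rel R (fun i => f (t i))

/-- Plays: nonempty finite sequences of moves (pebble index, element). -/
abbrev Play (k : ℕ) (α : Type) : Type := { s : List (Fin k × α) // s ≠ [] }

/-- The counit ε: the last component of the last move of a play. -/
def Play.eps {k : ℕ} {α : Type} (s : Play k α) : α := (s.1.getLast s.2).2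

/-- `Play.Active s t`: s ⊑ t and the pebble index of the last move of s does not
occur in the suffix of s in t. -/
def Play.Active {k : ℕ} {α : Type} (s t : Play k α) : Prop :=
  s.1 <+: t.1 ∧ ∀ m ∈ t.1.drop s.1.length, m.1 ≠ (s.1.getLast s.2).1

/-- The pebbling structure T_k A: a relation holds of a tuple of plays iff they are
pairwise ⊑-comparable — equivalently, all of them are prefixes of a ⊑-greatest one
`t j` — with the pebble index of the last move of each not reused in the corresponding
suffix, and the underlying relation holds of the last components. -/
def TStruct (k : ℕ) {σ : Signature} (A : Struct σ) : Struct σ where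
  carrier := Play k A.carrier
  rel R t := (∃ j, ∀ i, Play.Active (t i) (t j)) ∧ A.rel R (fun i => Play.eps (t i))

/-- The functorial action of T_k on maps: (p,a) ↦ (p, f a) in each move. -/
def Tmap {k : ℕ} {α β : Type} (f : α → β) (s : Play k α) : Play k β :=
  ⟨s.1.map (fun m => (m.1, f m.2)), by simpa using s.2⟩

/-- The (nonempty) prefix of length i+1 of a play. -/
def Play.prefixAt {k : ℕ} {α : Type} (s : Play k α) (i : ℕ) : Play k α :=
  ⟨s.1.take (i + 1), by
    obtain ⟨h, t, e⟩ := List.exists_cons_of_ne_nil s.2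
    simp [e]⟩

/-- The comultiplication δ: sends a play s = [(p₁,a₁),…,(pₙ,aₙ)] to
[(p₁,s₁),…,(pₙ,sₙ)] where sᵢ is the length-i prefix of s. -/
def delta {k : ℕ} {α : Type} (s : Play k α) : Play k (Play k α) :=
  ⟨List.ofFn (fun i : Fin s.1.length => ((s.1.get i).1, Play.prefixAt s i.1)), by
    have h : s.1.length ≠ 0 := by simpa using s.2
    simpa using h⟩

/-- The Kleisli coextension f* of f. -/
def coext {k : ℕ} {α β : Type} (f : Play k α → β) (s : Play k α) : Play k β :=
  Tmap f (delta s)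

/-- The inclusion T_l A → T_k A for l ≤ k, acting as the identity on sequences. -/
def incl {l k : ℕ} (h : l ≤ k) {α : Type} (s : Play l α) : Play k α :=
  ⟨s.1.map (fun m => (Fin.castLE h m.1, m.2)), by simpa using s.2⟩

/-- Configurations Γ_k(A,B): partial functions from pebble indices to pairs. -/
abbrev Conf (k : ℕ) (α β : Type) : Type := Fin k → Option (α × β)

/-- The empty configuration. -/
def Conf.empty {k : ℕ} {α β : Type} : Conf k α β := fun _ => none

/-- Update of a configuration: γ[p ↦ (a,b)]. -/
def Conf.update {k : ℕ} {α β : Type} (γ : Conf k α β) (p : Fin k) (a : α) (b : β) :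
    Conf k α β := Function.update γ p (some (a, b))

/-- Reversal of a configuration. -/
def Conf.rev {k : ℕ} {α β : Type} (γ : Conf k α β) : Conf k β α :=
  fun p => (γ p).map Prod.swap

def revSet {k : ℕ} {α β : Type} (S : Set (Conf k α β)) : Set (Conf k β α) :=
  Conf.rev '' S

/-- The relation R(γ) ⊆ A × B determined by a configuration. -/
def ConfRel {k : ℕ} {α β : Type} (γ : Conf k α β) (a : α) (b : β) : Prop :=
  ∃ p, γ p = some (a, b)

/-- Auxiliary: compute a position by processing Spoiler's moves (`rest`) in order,
Duplicator responding with f applied to the play so far. -/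
def posFrom {k : ℕ} {α β : Type} (f : Play k α → β) :
    List (Fin k × α) → List (Fin k × α) → Conf k α β → Conf k α β
  | _, [], γ => γ
  | pre, (p, a) :: rest, γ =>
      posFrom f (pre ++ [(p, a)]) rest
        (Conf.update γ p a (f ⟨pre ++ [(p, a)], by simp⟩))

/-- position(s, f*(s)): its domain is the set of pebble indices occurring in s, and it
sends p to (a,b) where (p,a) is the last move of s with index p and b is the
corresponding response in f*(s). -/
def positionOf {k : ℕ} {α β : Type} (f : Play k α → β) (s : Play k α) : Conf k α β :=
  posFrom f [] s.1 Conf.empty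

/-- S_f: the set of positions reached when Duplicator follows f, plus ∅. -/
def Sf {k : ℕ} {α β : Type} (f : Play k α → β) : Set (Conf k α β) :=
  { γ | ∃ s : Play k α, γ = positionOf f s } ∪ { Conf.empty }

/-- One update step between configurations. -/
def ConfStep {k : ℕ} {α β : Type} (γ γ' : Conf k α β) : Prop :=
  ∃ p a b, γ' = Conf.update γ p a b

/-- A strategy in positional form: contains ∅, has a Duplicator response for every
Spoiler move at every configuration, and every configuration of it is reachable
from ∅ by updates staying in it. -/
def IsStrategy {k : ℕ} {α β : Type} (S : Set (Conf k α β)) : Prop :=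
  Conf.empty ∈ S ∧
  (∀ γ ∈ S, ∀ (p : Fin k) (a : α), ∃ b, Conf.update γ p a b ∈ S) ∧
  (∀ γ ∈ S, Relation.ReflTransGen (fun x y => y ∈ S ∧ ConfStep x y) Conf.empty γ)

/-- A deterministic (positional) strategy: unique responses. -/
def Deterministic {k : ℕ} {α β : Type} (S : Set (Conf k α β)) : Prop :=
  ∀ γ ∈ S, ∀ (p : Fin k) (a : α), ∃! b, Conf.update γ p a b ∈ S

/-- A configuration is winning if R(γ) is a partial homomorphism. -/
def WinningConf {σ : Signature} (A B : Struct σ) {k : ℕ}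
    (γ : Conf k A.carrier B.carrier) : Prop :=
  ∀ (R : σ.Rel) (tA : Fin (σ.ar R) → A.carrier) (tB : Fin (σ.ar R) → B.carrier),
    (∀ i, ConfRel γ (tA i) (tB i)) → A.rel R tA → B.rel R tB

/-- A set of configurations is winning if all its members are. -/
def WinningSet {σ : Signature} (A B : Struct σ) {k : ℕ}
    (S : Set (Conf k A.carrier B.carrier)) : Prop :=
  ∀ γ ∈ S, WinningConf A B γ

/-- The signature σ extended with a binary symbol I. -/
def WithI (σ : Signature) : Signature :=
  ⟨σ.Rel ⊕ Unit, Sum.elim σ.ar (fun _ => 2)⟩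

/-- An I-structure: a (σ ∪ {I})-structure interpreting I as the identity relation. -/
def IsIStruct {σ : Signature} (A : Struct (WithI σ)) : Prop :=
  ∀ t : Fin 2 → A.carrier, A.rel (Sum.inr ()) t ↔ t 0 = t 1

/-- The one-step functions ψ_{s,p} associated to f : T_k A → B, where s ranges over
plays together with the empty sequence. -/
def psi {k : ℕ} {α β : Type} (f : Play k α → β) (s : List (Fin k × α)) (p : Fin k)
    (a : α) : β := f ⟨s ++ [(p, a)], by simp⟩

/-- A partial isomorphism: a single-valued, injective relation such that both it and
its converse are partial homomorphisms. -/
def IsPartialIso {σ : Signature} (A B : Struct σ) (r : A.carrier → B.carrier → Prop) :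
    Prop :=
  (∀ a b b', r a b → r a b' → b = b') ∧
  (∀ a a' b, r a b → r a' b → a = a') ∧
  (∀ (R : σ.Rel) (tA : Fin (σ.ar R) → A.carrier) (tB : Fin (σ.ar R) → B.carrier),
    (∀ i, r (tA i) (tB i)) → (A.rel R tA ↔ B.rel R tB))

/-- A →ᵏᵢ B: a co-Kleisli morphism all of whose one-step functions are injective. -/
def ArrowI (k : ℕ) {σ : Signature} (A B : Struct σ) : Prop :=
  ∃ f : Play k A.carrier → B.carrier, IsHom (TStruct k A) B f ∧
    ∀ s p, Function.Injective (psi f s p)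

/-- A →ᵏₛ B: a co-Kleisli morphism all of whose one-step functions are surjective. -/
def ArrowS (k : ℕ) {σ : Signature} (A B : Struct σ) : Prop :=
  ∃ f : Play k A.carrier → B.carrier, IsHom (TStruct k A) B f ∧
    ∀ s p, Function.Surjective (psi f s p)

/-- A →ᵏᵦ B: a co-Kleisli morphism with all one-step functions bijective and all
reached positions partial isomorphisms. -/
def ArrowB (k : ℕ) {σ : Signature} (A B : Struct σ) : Prop :=
  ∃ f : Play k A.carrier → B.carrier, IsHom (TStruct k A) B f ∧
    (∀ s p, Function.Bijective (psi f s p)) ∧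
    ∀ s : Play k A.carrier, IsPartialIso A B (ConfRel (positionOf f s))

/-- Isomorphism in the co-Kleisli category of T_k. -/
def CoKIso (k : ℕ) {σ : Signature} (A B : Struct σ) : Prop :=
  ∃ (f : Play k A.carrier → B.carrier) (g : Play k B.carrier → A.carrier),
    IsHom (TStruct k A) B f ∧ IsHom (TStruct k B) A g ∧
    (∀ s : Play k A.carrier, g (coext f s) = Play.eps s) ∧
    (∀ t : Play k B.carrier, f (coext g t) = Play.eps t)

/-- The Gaifman graph adjacency relation of a structure. -/
def Gaifman {σ : Signature} (A : Struct σ) (a b : A.carrier) : Prop :=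
  a ≠ b ∧ ∃ (R : σ.Rel) (t : Fin (σ.ar R) → A.carrier),
    A.rel R t ∧ (∃ i, t i = a) ∧ (∃ i, t i = b)

/-- A coalgebra for the comonad T_k. -/
def IsCoalgebra {σ : Signature} (A : Struct σ) (k : ℕ)
    (f : A.carrier → Play k A.carrier) : Prop :=
  IsHom A (TStruct k A) f ∧ (∀ a, Play.eps (f a) = a) ∧
    (∀ a, delta (f a) = Tmap f (f a))

/-- A tree decomposition of a σ-structure. -/
structure TreeDecomp {σ : Signature} (A : Struct σ) where
  V : Type
  G : SimpleGraph V
  isTree : G.IsTree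
  bag : V → Set A.carrier
  covers_elem : ∀ x : A.carrier, ∃ t, x ∈ bag t
  covers_rel : ∀ (R : σ.Rel) (tup : Fin (σ.ar R) → A.carrier),
    A.rel R tup → ∃ t, ∀ i, tup i ∈ bag t
  bag_connected : ∀ x : A.carrier, (G.induce { t | x ∈ bag t }).Connected

/-- A has a tree decomposition all of whose bags have at most k elements
(i.e. tw(A) < k). -/
def HasWidthUnder {σ : Signature} (A : Struct σ) (k : ℕ) : Prop :=
  ∃ d : TreeDecomp A, ∀ t, (d.bag t).Finite ∧ (d.bag t).ncard ≤ k

/-- The induced substructure on a subset of the carrier. -/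
def induceStruct {σ : Signature} (A : Struct σ) (S : Set A.carrier) : Struct σ where
  carrier := ↥S
  rel R t := A.rel R (fun i => (t i).1)

/-- S carries a core of A: the induced substructure admits a homomorphism from A,
and no proper substructure of it does. -/
def IsCore {σ : Signature} (A : Struct σ) (S : Set A.carrier) : Prop :=
  (∃ h, IsHom A (induceStruct A S) h) ∧
  ∀ S' : Set A.carrier, S' ⊂ S → ¬ ∃ h, IsHom A (induceStruct A S') h

namespace Play

variable {k : ℕ} {α β : Type}

/-- The pebble index of the last move of a play. -/
def lastPebble (s : Play k α) : Fin k := (s.1.getLast s.2).1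

@[simp]
theorem length_delta (s : Play k α) : (delta s).1.length = s.1.length := by
  simp [delta]

theorem getElem_delta (s : Play k α) (i : ℕ) (hi : i < (delta s).1.length) :
    (delta s).1[i] = ((s.1[i]'(by simpa using hi)).1, s.prefixAt i) := by
  simp [delta]

theorem getLast_delta (s : Play k α) :
    (delta s).1.getLast (delta s).2 = (s.lastPebble, s) := by
  have h : 0 < s.1.length := List.length_pos_iff.2 s.2
  rw [List.getLast_eq_getElem, getElem_delta]
  refine Prod.ext ?_ (Subtype.ext ?_)
  · simp [lastPebble, List.getLast_eq_getElem]
  · simp [prefixAt, Nat.sub_add_cancel h]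

theorem eps_delta (s : Play k α) : (delta s).eps = s := by
  rw [eps, getLast_delta]

theorem prefixAt_eq_of_prefix {s t : Play k α} (h : s.1 <+: t.1) {i : ℕ}
    (hi : i < s.1.length) : s.prefixAt i = t.prefixAt i := by
  obtain ⟨u, hu⟩ := h
  apply Subtype.ext
  simp only [prefixAt, ← hu]
  rw [List.take_append_of_le_length (by omega)]

theorem delta_prefix {s t : Play k α} (h : s.1 <+: t.1) : (delta s).1 <+: (delta t).1 := by
  rw [List.prefix_iff_getElem]
  refine ⟨by simpa using h.length_le, fun i hi => ?_⟩
  have hs : i < s.1.length := by simpa using hi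
  rw [getElem_delta, getElem_delta, prefixAt_eq_of_prefix h hs, h.getElem hs]

theorem Active.delta {s t : Play k α} (h : s.Active t) : (delta s).Active (delta t) := by
  refine ⟨delta_prefix h.1, fun m hm => ?_⟩
  rw [getLast_delta]
  obtain ⟨i, hi, rfl⟩ := List.mem_iff_getElem.1 hm
  rw [List.getElem_drop, getElem_delta]
  simp only [length_delta]
  have hi' : i < (t.1.drop s.1.length).length := by simpa using hi
  simpa [lastPebble] using h.2 _ (List.getElem_mem hi')

theorem Tmap_prefixAt (f : α → β) (s : Play k α) (i : ℕ) :
    Tmap f (s.prefixAt i) = (Tmap f s).prefixAt i :=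
  Subtype.ext List.map_take

theorem Tmap_Tmap_delta (f : α → β) (s : Play k α) :
    Tmap (Tmap f) (delta s) = delta (Tmap f s) := by
  refine Subtype.ext (List.ext_getElem (by simp [Tmap]) fun i h₁ h₂ => ?_)
  rw [getElem_delta, ← Tmap_prefixAt]
  simp [Tmap, getElem_delta]

end Play

theorem isHom_delta {σ : Signature} (k : ℕ) (A : Struct σ) :
    IsHom (TStruct k A) (TStruct k (TStruct k A)) delta := by
  rintro R t ⟨⟨j, hj⟩, hR⟩
  refine ⟨⟨j, fun i => (hj i).delta⟩, ?_⟩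
  have h : (fun i => (delta (t i)).eps) = t := funext fun i => Play.eps_delta (t i)
  exact h.symm ▸ ⟨⟨j, hj⟩, hR⟩

/-- δ_A is a homomorphism T_k A → T_k T_k A, and δ is natural:
(T_k T_k f) ∘ δ_A = δ_B ∘ T_k f for every homomorphism f : A → B. -/
theorem delta_hom_and_natural {σ : Signature} (k : ℕ) (hk : 0 < k) (A : Struct σ) :
    IsHom (TStruct k A) (TStruct k (TStruct k A)) delta ∧
    ∀ (B : Struct σ) (f : A.carrier → B.carrier), IsHom A B f →
      ∀ s : Play k A.carrier, Tmap (Tmap f) (delta s) = delta (Tmap f s) := by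
  exact ⟨isHom_delta k A, fun _ f _ s => Play.Tmap_Tmap_delta f s⟩
end

section
/- Suppose the signature σ contains a binary relation symbol E. There is no map Q assigning to each finite σ-structure A a finite σ-structure QA such that for all finite σ-structures A and B: there exists a homomorphism QA → B if and only if A →_2 B (i.e., there exists a homomorphism T_2 A → B). -/
/-- The directed cycle of length `n` (a bi-infinite path for `n = 0`), with all symbols other
than `E` interpreted as empty. -/
def cycleStruct {σ : Signature} (E : σ.Rel) (n : ℕ) : Struct σ where
  carrier := ZMod n
  rel R t := R = E ∧ ∀ i j : Fin (σ.ar R), i.val = 0 → j.val = 1 → t j = t i + 1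

/-- The representative in `{-1, 0, 1}` of an element of `ZMod 3`, read in `ZMod n`. -/
def signedStep (n : ℕ) (d : ZMod 3) : ZMod n :=
  if d = 1 then 1 else if d = -1 then -1 else 0

theorem signedStep_neg (n : ℕ) (d : ZMod 3) : signedStep n (-d) = -signedStep n d := by
  have h : (1 : ZMod 3) ≠ -1 := by decide
  by_cases h₁ : d = 1
  · simp [signedStep, h₁, h.symm]
  · by_cases h₂ : d = -1
    · simp [signedStep, h₂, h.symm]
    · have h₃ : -d ≠ 1 := fun e => h₂ (by rw [← e, neg_neg])
      simp [signedStep, h₁, h₂, h₃]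

/-- Process one move, recording for each pebble its position and its level; the level of the
moved pebble is determined by its displacement from the other pebble. -/
def levelStep (n : ℕ) (γ : Fin 2 → ZMod 3 × ZMod n) (m : Fin 2 × ZMod 3) :
    Fin 2 → ZMod 3 × ZMod n :=
  Function.update γ m.1
    (m.2, (γ (1 - m.1)).2 + signedStep n (m.2 - (γ (1 - m.1)).1))

/-- The positions and levels of the two pebbles after a sequence of moves. -/
def levels (n : ℕ) (l : List (Fin 2 × ZMod 3)) : Fin 2 → ZMod 3 × ZMod n :=
  l.foldl (levelStep n) (fun _ => (0, 0))

theorem levels_concat (n : ℕ) (l : List (Fin 2 × ZMod 3)) (m : Fin 2 × ZMod 3) :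
    levels n (l ++ [m]) = levelStep n (levels n l) m := by
  simp [levels]

theorem levels_append_of_notMem (n : ℕ) (l l' : List (Fin 2 × ZMod 3)) (q : Fin 2)
    (h : ∀ m ∈ l', m.1 ≠ q) : levels n (l ++ l') q = levels n l q := by
  induction l' using List.reverseRecOn with
  | nil => simp
  | append_singleton l' m ih =>
    rw [← List.append_assoc, levels_concat, levelStep,
      Function.update_of_ne (h m (by simp)).symm]
    exact ih fun m' hm' => h m' (by simp [hm'])

/-- The level of a play: the level of the pebble moved last. -/
def Play.level (n : ℕ) (s : Play 2 (ZMod 3)) : ZMod n :=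
  (levels n s.1 (s.1.getLast s.2).1).2

theorem levels_getLast (n : ℕ) (s : Play 2 (ZMod 3)) :
    levels n s.1 (s.1.getLast s.2).1 = (s.eps, s.level n) := by
  obtain ⟨l, hl⟩ := s
  induction l using List.reverseRecOn with
  | nil => exact absurd rfl hl
  | append_singleton l m _ => simp [Play.level, Play.eps, levels_concat, levelStep]

theorem Play.Active.level_eq {n : ℕ} {s t : Play 2 (ZMod 3)} (h : Play.Active s t)
    (hne : s ≠ t) : t.level n = s.level n + signedStep n (t.eps - s.eps) := by
  have hs := levels_getLast n s
  obtain ⟨s, hs₀⟩ := s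
  obtain ⟨t, ht₀⟩ := t
  obtain ⟨⟨l, hl⟩, hd⟩ := h
  dsimp only at hl
  subst hl
  dsimp only at hs hd
  rw [List.drop_left] at hd
  induction l using List.reverseRecOn with
  | nil => simp at hne
  | append_singleton l m _ =>
    have hother : 1 - m.1 = (s.getLast hs₀).1 := by
      have := hd m (by simp)
      omega
    have hpos := levels_append_of_notMem n s l _
      fun m' hm' => hd m' (List.mem_append_left _ hm')
    rw [hs] at hpos
    simp [Play.level, Play.eps, ← List.append_assoc, levels_concat, levelStep, hother] at hpos ⊢
    simp [hpos]

theorem Play.level_eq_add_one {s t : Play 2 (ZMod 3)} (n : ℕ)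
    (hact : Play.Active s t ∨ Play.Active t s) (hstep : t.eps = s.eps + 1) :
    t.level n = s.level n + 1 := by
  have hne : s ≠ t := fun e => by simp [e] at hstep
  rcases hact with h | h
  · rw [h.level_eq hne, hstep, add_sub_cancel_left]
    simp [signedStep]
  · rw [h.level_eq hne.symm, hstep, sub_add_cancel_left, signedStep_neg]
    simp [signedStep]

/-- Unravelling the directed triangle yields a forest, which maps to every directed cycle. -/
theorem isHom_level {σ : Signature} (E : σ.Rel) (hE : σ.ar E = 2) (n : ℕ) :
    IsHom (TStruct 2 (cycleStruct E 3)) (cycleStruct E n) (Play.level n) := by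
  rintro R t ⟨⟨k, hk⟩, rfl, hR⟩
  refine ⟨rfl, fun i j hi hj => Play.level_eq_add_one n ?_ (hR i j hi hj)⟩
  have hk' : k = i ∨ k = j := by
    simp only [Fin.ext_iff]
    omega
  rcases hk' with rfl | rfl
  · exact .inr (hk j)
  · exact .inl (hk i)

/-- The play walking around the directed triangle with alternating pebbles. -/
def walkPlay (i : ℕ) : Play 2 (ZMod 3) :=
  ⟨(List.range (i + 1)).map fun j => (Fin.ofNat 2 j, (j : ZMod 3)), by simp⟩

theorem walkPlay_succ (i : ℕ) : (walkPlay (i + 1)).1 =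
    (walkPlay i).1 ++ [(Fin.ofNat 2 (i + 1), ((i + 1 : ℕ) : ZMod 3))] := by
  simp only [walkPlay, List.range_succ (n := i + 1), List.map_append, List.map_singleton]

theorem walkPlay_getLast (i : ℕ) :
    (walkPlay i).1.getLast (walkPlay i).2 = (Fin.ofNat 2 i, (i : ZMod 3)) := by
  simp only [walkPlay, List.getLast_map, List.getLast_range, Nat.add_sub_cancel]

theorem walkPlay_active_succ (i : ℕ) : Play.Active (walkPlay i) (walkPlay (i + 1)) := by
  refine ⟨⟨_, (walkPlay_succ i).symm⟩, ?_⟩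
  rw [walkPlay_succ, List.drop_left]
  intro m hm
  rw [List.mem_singleton.1 hm, Ne, Fin.ext_iff, walkPlay_getLast]
  simp only [Fin.ofNat]
  omega

theorem walkPlay_rel {σ : Signature} (E : σ.Rel) (hE : σ.ar E = 2) (i : ℕ) :
    (TStruct 2 (cycleStruct E 3)).rel E
      (fun k => if k.val = 0 then walkPlay i else walkPlay (i + 1)) := by
  refine ⟨⟨⟨1, by omega⟩, fun k => ?_⟩, rfl, fun a b ha hb => ?_⟩
  · by_cases hk : k.val = 0
    · simp only [hk, one_ne_zero, ↓reduceIte]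
      exact walkPlay_active_succ i
    · simp only [hk, one_ne_zero, ↓reduceIte]
      exact ⟨List.prefix_refl _, by simp⟩
  · simp only [ha, hb, one_ne_zero, ↓reduceIte, Play.eps]
    exact (congrArg Prod.snd (walkPlay_getLast (i + 1))).trans
      ((Nat.cast_succ i).trans (congrArg (· + 1) (congrArg Prod.snd (walkPlay_getLast i)).symm))

theorem hom_walkPlay_eq {σ : Signature} (E : σ.Rel) (hE : σ.ar E = 2) {n : ℕ}
    {f : Play 2 (ZMod 3) → ZMod n}
    (hf : IsHom (TStruct 2 (cycleStruct E 3)) (cycleStruct E n) f) (i : ℕ) :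
    f (walkPlay i) = f (walkPlay 0) + i := by
  induction i with
  | zero => simp
  | succ i ih =>
    have h := (hf E _ (walkPlay_rel E hE i)).2 ⟨0, by omega⟩ ⟨1, by omega⟩ rfl rfl
    simp only [one_ne_zero, ↓reduceIte] at h
    rw [h, ih]
    push_cast
    ring

/-- no-go theorem: if σ contains a binary relation symbol E, there is no
construction Q on finite σ-structures with QA finite such that for all finite B,
QA → B iff A →₂ B (i.e. iff there is a homomorphism T₂ A → B). -/
theorem no_finite_representation (σ : Signature) (E : σ.Rel) (hE : σ.ar E = 2) :
    ¬ ∃ Q : { A : Struct σ // Finite A.carrier } → { A : Struct σ // Finite A.carrier },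
      ∀ A B : { A : Struct σ // Finite A.carrier },
        (∃ h, IsHom (Q A).1 B.1 h) ↔ (∃ h, IsHom (TStruct 2 A.1) B.1 h) := by
  rintro ⟨Q, hQ⟩
  let A : { A : Struct σ // Finite A.carrier } :=
    ⟨cycleStruct E 3, inferInstanceAs (Finite (ZMod 3))⟩
  obtain ⟨g, hg⟩ := (hQ A (Q A)).1 ⟨id, fun _ _ h => h⟩
  have := (Q A).2
  obtain ⟨i, j, hij, hgij⟩ := Finite.exists_ne_map_eq_of_infinite fun i => g (walkPlay i)
  let B : { A : Struct σ // Finite A.carrier } :=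
    ⟨cycleStruct E (i + j + 1), inferInstanceAs (Finite (ZMod (i + j + 1)))⟩
  obtain ⟨h, hh⟩ := (hQ A B).2 ⟨_, isHom_level E hE (i + j + 1)⟩
  have hwalk := hom_walkPlay_eq (n := i + j + 1) (f := h ∘ g) E hE fun R t ht => hh R _ (hg R t ht)
  have heq : (i : ZMod (i + j + 1)) = j :=
    add_left_cancel ((hwalk i).symm.trans ((congrArg h hgij).trans (hwalk j)))
  rw [ZMod.natCast_eq_natCast_iff', Nat.mod_eq_of_lt (by omega),
    Nat.mod_eq_of_lt (by omega)] at heq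
  exact hij heq
end

section
/- Let A and B be finite σ-structures and k a positive integer. (i) For every function f : T_k A → B, the set S_f is a strategy in positional form. (ii) Conversely, for every strategy in positional form S ⊆ Γ_k(A,B) there exists a function f : T_k A → B with S_f = S. -/
theorem mem_Sf_iff {k : ℕ} {α β : Type} {f : Play k α → β} {γ : Conf k α β} :
    γ ∈ Sf f ↔ ∃ l, posFrom f [] l Conf.empty = γ := by
  constructor
  · rintro (⟨s, rfl⟩ | rfl)
    · exact ⟨s.1, rfl⟩
    · exact ⟨[], rfl⟩
  · rintro ⟨l, rfl⟩
    by_cases hl : l = []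
    · subst hl
      exact Or.inr rfl
    · exact Or.inl ⟨⟨l, hl⟩, rfl⟩

theorem posFrom_concat {k : ℕ} {α β : Type} (f : Play k α → β) (p : Fin k) (a : α)
    (l pre : List (Fin k × α)) (γ : Conf k α β) :
    posFrom f pre (l ++ [(p, a)]) γ =
      Conf.update (posFrom f pre l γ) p a (f ⟨pre ++ l ++ [(p, a)], by simp⟩) := by
  induction l generalizing pre γ with
  | nil => simp [posFrom]
  | cons m l ih =>
    obtain ⟨q, c⟩ := m
    simp [posFrom, ih]

theorem Conf.update_update {k : ℕ} {α β : Type} (γ : Conf k α β) (p : Fin k) (a a' : α)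
    (b b' : β) : (γ.update p a b).update p a' b' = γ.update p a' b' := by
  simp [Conf.update]

/-- The positions reached by following a function form a strategy. -/
theorem isStrategy_Sf {k : ℕ} {α β : Type} (f : Play k α → β) : IsStrategy (Sf f) := by
  refine ⟨Or.inr rfl, ?_, ?_⟩
  · intro γ hγ p a
    obtain ⟨l, rfl⟩ := mem_Sf_iff.1 hγ
    exact ⟨_, mem_Sf_iff.2 ⟨l ++ [(p, a)], posFrom_concat f p a l [] _⟩⟩
  · intro γ hγ
    obtain ⟨l, rfl⟩ := mem_Sf_iff.1 hγ
    clear hγ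
    induction l using List.reverseRecOn with
    | nil => exact .refl
    | append_singleton l m ih =>
      exact ih.tail ⟨mem_Sf_iff.2 ⟨_, rfl⟩, m.1, m.2, _, posFrom_concat f m.1 m.2 l [] _⟩

/-- A sequence enumerating every element of a countable type infinitely often. -/
theorem exists_enumeration_infinitely_often (β : Type) [Countable β] :
    ∃ e : ℕ → Option β, ∀ b N, ∃ d, e (N + d) = some b := by
  obtain ⟨_⟩ := nonempty_encodable β
  refine ⟨fun n => Encodable.decode n.unpair.1, fun b N => ?_⟩
  obtain ⟨d, hd⟩ := Nat.exists_eq_add_of_le (Nat.right_le_pair (Encodable.encode b) N)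
  exact ⟨d, by simp [← hd]⟩

/-- The configuration of `S` and the number of moves made, after one more move of Spoiler
which Duplicator answers by `r`. -/
def stepWith {k : ℕ} {α β : Type} {S : Set (Conf k α β)} (r : S → ℕ → Fin k → α → β)
    (hr : ∀ (γ : S) n p a, γ.1.update p a (r γ n p a) ∈ S) (st : S × ℕ) (m : Fin k × α) : S × ℕ :=
  (⟨st.1.1.update m.1 m.2 (r st.1 st.2 m.1 m.2), hr _ _ _ _⟩, st.2 + 1)

/-- The answer to the last move of a play given by the response function `r`. -/
def playWith {k : ℕ} {α β : Type} {S : Set (Conf k α β)} (r : S → ℕ → Fin k → α → β)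
    (hr : ∀ (γ : S) n p a, γ.1.update p a (r γ n p a) ∈ S) (h₀ : Conf.empty ∈ S)
    (s : Play k α) : β :=
  let st := s.1.dropLast.foldl (stepWith r hr) (⟨Conf.empty, h₀⟩, 0)
  r st.1 st.2 (s.1.getLast s.2).1 (s.1.getLast s.2).2

theorem posFrom_playWith {k : ℕ} {α β : Type} {S : Set (Conf k α β)}
    (r : S → ℕ → Fin k → α → β) (hr : ∀ (γ : S) n p a, γ.1.update p a (r γ n p a) ∈ S)
    (h₀ : Conf.empty ∈ S) (l : List (Fin k × α)) :
    posFrom (playWith r hr h₀) [] l Conf.empty =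
      (l.foldl (stepWith r hr) (⟨Conf.empty, h₀⟩, 0)).1.1 := by
  induction l using List.reverseRecOn with
  | nil => rfl
  | append_singleton l m ih =>
    obtain ⟨p, a⟩ := m
    simp [posFrom_concat, ih, playWith, stepWith]

/-- If `r` answers `b` whenever `e` proposes `b` and this is legal, then repeating a move
until `e` proposes `b` results in the answer `b`. -/
theorem foldl_stepWith_replicate {k : ℕ} {α β : Type} {S : Set (Conf k α β)}
    (r : S → ℕ → Fin k → α → β) (hr : ∀ (γ : S) n p a, γ.1.update p a (r γ n p a) ∈ S)
    {e : ℕ → Option β}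
    (he : ∀ (γ : S) n p a b, e n = some b → γ.1.update p a b ∈ S → r γ n p a = b)
    {p : Fin k} {a : α} {b : β} (d : ℕ) (st : S × ℕ) (hd : e (st.2 + d) = some b)
    (hb : st.1.1.update p a b ∈ S) :
    ((List.replicate (d + 1) (p, a)).foldl (stepWith r hr) st).1.1 =
      st.1.1.update p a b := by
  induction d generalizing st with
  | zero => simp [stepWith, he st.1 st.2 p a b hd hb]
  | succ d ih =>
    rw [List.replicate_succ, List.foldl_cons, ih]
    · exact Conf.update_update ..
    · rw [← hd]
      congr 1
      simp only [stepWith]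
      omega
    · simpa only [stepWith, Conf.update_update] using hb

/-- Every strategy over a countable set of responses consists of the positions reached by
following some function. -/
theorem IsStrategy.exists_Sf_eq {k : ℕ} {α β : Type} [Countable β] {S : Set (Conf k α β)}
    (hS : IsStrategy S) : ∃ f : Play k α → β, Sf f = S := by
  obtain ⟨h₀, hstep, hreach⟩ := hS
  obtain ⟨e, he⟩ := exists_enumeration_infinitely_often β
  have hresp : ∀ (γ : S) (n : ℕ) (p : Fin k) (a : α), ∃ b, γ.1.update p a b ∈ S ∧
      ∀ b', e n = some b' → γ.1.update p a b' ∈ S → b = b' := by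
    intro γ n p a
    by_cases h : ∃ b, e n = some b ∧ γ.1.update p a b ∈ S
    · obtain ⟨b, hb, hbS⟩ := h
      exact ⟨b, hbS, fun b' hb' _ => Option.some.inj (hb.symm.trans hb')⟩
    · obtain ⟨b, hb⟩ := hstep γ.1 γ.2 p a
      exact ⟨b, hb, fun b' hb' hbS => absurd ⟨b', hb', hbS⟩ h⟩
  choose r hr hre using hresp
  refine ⟨playWith r hr h₀, Set.ext fun γ => ?_⟩
  simp only [mem_Sf_iff, posFrom_playWith]
  constructor
  · rintro ⟨l, rfl⟩
    exact Subtype.property _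
  · intro hγ
    induction hreach γ hγ with
    | refl => exact ⟨[], rfl⟩
    | @tail γ₁ γ₂ h₁ h₂ ih =>
      obtain ⟨hmem, p, a, b, rfl⟩ := h₂
      have hγ₁ : γ₁ ∈ S := by
        rcases Relation.ReflTransGen.cases_tail h₁ with rfl | ⟨_, _, h, _⟩
        exacts [h₀, h]
      obtain ⟨l, rfl⟩ := ih hγ₁
      obtain ⟨d, hd⟩ := he b (l.foldl (stepWith r hr) (⟨Conf.empty, h₀⟩, 0)).2
      refine ⟨l ++ List.replicate (d + 1) (p, a), ?_⟩
      rw [List.foldl_append]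
      exact foldl_stepWith_replicate r hr hre d _ hd hmem

/-- (i) for every function f : T_k A → B, S_f is a strategy in positional
form; (ii) every strategy in positional form S equals S_f for some f : T_k A → B. -/
theorem positional_representation {σ : Signature} (A B : Struct σ)
    [Fintype A.carrier] [Fintype B.carrier] (k : ℕ) (hk : 0 < k) :
    (∀ f : Play k A.carrier → B.carrier, IsStrategy (Sf f)) ∧
    (∀ S : Set (Conf k A.carrier B.carrier), IsStrategy S →
      ∃ f : Play k A.carrier → B.carrier, Sf f = S) := 
  ⟨isStrategy_Sf, fun _ hS => hS.exists_Sf_eq⟩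
end

section
/- For all finite σ-structures A and B and any positive integer k: Duplicator has a winning strategy in the k-pebble bijection game between A and B if and only if A →_k^b B. -/
/-- Duplicator has a winning strategy in the k-pebble bijection game between A and B. -/
def BijGameWin {σ : Signature} (A B : Struct σ) (k : ℕ) : Prop :=
  ∃ S : Set (Conf k A.carrier B.carrier), Conf.empty ∈ S ∧
    ∀ γ ∈ S, ∀ p : Fin k, ∃ h : A.carrier → B.carrier, Function.Bijective h ∧
      (∀ (q : Fin k) (a : A.carrier) (b : B.carrier),
        q ≠ p → γ q = some (a, b) → h a = b) ∧
      ∀ a : A.carrier, Conf.update γ p a (h a) ∈ S ∧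
        IsPartialIso A B (ConfRel (Conf.update γ p a (h a)))

section Positions

variable {k : ℕ} {α β : Type} (f : Play k α → β)

theorem posFrom_append (pre l₁ l₂ : List (Fin k × α)) (γ : Conf k α β) :
    posFrom f pre (l₁ ++ l₂) γ = posFrom f (pre ++ l₁) l₂ (posFrom f pre l₁ γ) := by
  induction l₁ generalizing pre γ with
  | nil => simp [posFrom]
  | cons m l ih =>
    obtain ⟨p, a⟩ := m
    simp [posFrom, ih]

theorem posFrom_nil_concat (l : List (Fin k × α)) (p : Fin k) (a : α) :
    posFrom f [] (l ++ [(p, a)]) Conf.empty =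
      Conf.update (posFrom f [] l Conf.empty) p a (psi f l p a) := by
  simp [posFrom_append, posFrom, psi]

theorem posFrom_apply_of_forall_ne (pre l : List (Fin k × α)) (γ : Conf k α β) (p : Fin k)
    (h : ∀ m ∈ l, m.1 ≠ p) : posFrom f pre l γ p = γ p := by
  induction l generalizing pre γ with
  | nil => rfl
  | cons m l ih =>
    obtain ⟨q, a⟩ := m
    have hq : p ≠ q := fun e => h (q, a) (by simp) e.symm
    rw [posFrom, ih _ _ fun m hm => h m (List.mem_cons_of_mem _ hm)]
    simp [Conf.update, hq]

theorem positionOf_apply_getLast (s : Play k α) :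
    positionOf f s (s.1.getLast s.2).1 = some (s.eps, f s) := by
  obtain ⟨l, hl⟩ := s
  obtain rfl | ⟨l, ⟨p, a⟩, rfl⟩ := l.eq_nil_or_concat'
  · exact absurd rfl hl
  · simp [positionOf, posFrom_nil_concat, Conf.update, psi, Play.eps]

variable {f} in
theorem Play.Active.confRel {s t : Play k α} (h : s.Active t) :
    ConfRel (positionOf f t) s.eps (f s) := by
  obtain ⟨⟨u, hu⟩, hne⟩ := h
  rw [← hu, List.drop_left] at hne
  refine ⟨(s.1.getLast s.2).1, ?_⟩
  rw [positionOf, ← hu, posFrom_append, posFrom_apply_of_forall_ne _ _ _ _ _ hne]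
  exact positionOf_apply_getLast f s

end Positions

section Strategies

variable {k : ℕ} {σ : Signature} {A B : Struct σ}

theorem isHom_of_isPartialIso_positionOf {f : Play k A.carrier → B.carrier}
    (hf : ∀ s, IsPartialIso A B (ConfRel (positionOf f s))) : IsHom (TStruct k A) B f := by
  rintro R t ⟨⟨j, hj⟩, hR⟩
  exact ((hf (t j)).2.2 R _ _ fun i => (hj i).confRel).1 hR

theorem ArrowB.bijGameWin (h : ArrowB k A B) : BijGameWin A B k := by
  obtain ⟨f, -, hbij, hiso⟩ := h
  refine ⟨Set.range fun l => posFrom f [] l Conf.empty, ⟨[], rfl⟩, ?_⟩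
  rintro _ ⟨l, rfl⟩ p
  have hstep (a : A.carrier) := posFrom_nil_concat f l p a
  have hiso' (a : A.carrier) : IsPartialIso A B
      (ConfRel (Conf.update (posFrom f [] l Conf.empty) p a (psi f l p a))) := by
    rw [← hstep]
    exact hiso ⟨l ++ [(p, a)], by simp⟩
  refine ⟨psi f l p, hbij l p, fun q a b hq hγ => ?_, fun a => ⟨⟨_, hstep a⟩, hiso' a⟩⟩
  exact (hiso' a).1 a _ _ ⟨p, by simp [Conf.update]⟩ ⟨q, by simpa [Conf.update, hq] using hγ⟩

theorem BijGameWin.arrowB (h : BijGameWin A B k) : ArrowB k A B := by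
  obtain ⟨S, hS, H⟩ := h
  choose! h hbij _ hwin using fun γ : S => H γ.1 γ.2
  let conf (l : List (Fin k × A.carrier)) : S :=
    l.foldl (fun γ m => ⟨Conf.update γ.1 m.1 m.2 (h γ m.1 m.2), (hwin γ m.1 m.2).1⟩)
      ⟨Conf.empty, hS⟩
  let f (s : Play k A.carrier) : B.carrier :=
    h (conf s.1.dropLast) (s.1.getLast s.2).1 (s.1.getLast s.2).2
  have hpsi (l p) : psi f l p = h (conf l) p := by
    funext a
    simp [psi, f]
  have hconf (l) : posFrom f [] l Conf.empty = (conf l).1 := by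
    induction l using List.reverseRecOn with
    | nil => rfl
    | append_singleton l m ih =>
      rw [posFrom_nil_concat, ih, hpsi]
      simp [conf]
  have hiso (s : Play k A.carrier) : IsPartialIso A B (ConfRel (positionOf f s)) := by
    obtain ⟨l, hl⟩ := s
    obtain rfl | ⟨l, ⟨p, a⟩, rfl⟩ := l.eq_nil_or_concat'
    · exact absurd rfl hl
    · rw [positionOf]; dsimp only; rw [posFrom_nil_concat, hconf, hpsi]
      exact (hwin (conf l) p a).2
  exact ⟨f, isHom_of_isPartialIso_positionOf hiso, fun s p => hpsi s p ▸ hbij _ p, hiso⟩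

end Strategies

/-- Duplicator has a winning strategy in the k-pebble bijection game
between finite A and B iff A →_k^b B. -/
theorem bijection_game_iff_arrowB {σ : Signature} (A B : Struct σ)
    [Fintype A.carrier] [Fintype B.carrier] (k : ℕ) (hk : 0 < k) :
    BijGameWin A B k ↔ ArrowB k A B :=
  ⟨BijGameWin.arrowB, ArrowB.bijGameWin⟩
end

section
/- For every σ-structure A and every positive integer k, the structure T_k A admits a tree decomposition in which every bag has at most k elements; consequently tw(T_k A) < k. -/
/-- The prefix tree on lists: each list is adjacent to its one-letter extensions. -/
def prefixTree (α : Type) : SimpleGraph (List α) where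
  Adj s t := (∃ m, t = s ++ [m]) ∨ (∃ m, s = t ++ [m])
  symm := ⟨fun _ _ h => h.symm⟩
  loopless := ⟨by
    rintro s (⟨m, h⟩ | ⟨m, h⟩) <;> simpa using congrArg List.length h⟩

lemma prefixTree_adj_concat {α : Type} (s : List α) (m : α) :
    (prefixTree α).Adj s (s ++ [m]) :=
  Or.inl ⟨m, rfl⟩

lemma prefixTree_connected (α : Type) : (prefixTree α).Connected := by
  rw [SimpleGraph.connected_iff_exists_forall_reachable]
  refine ⟨[], fun s => ?_⟩
  induction s using List.reverseRecOn with
  | nil => exact SimpleGraph.Reachable.refl _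
  | append_singleton s m ih => exact ih.trans (prefixTree_adj_concat s m).reachable

lemma prefixTree_isBridge {α : Type} (s : List α) (m : α) :
    (prefixTree α).IsBridge s(s, s ++ [m]) := by
  rw [SimpleGraph.isBridge_iff]
  intro h
  have key : ∀ x y, ((prefixTree α).deleteEdges {s(s, s ++ [m])}).Adj x y →
      (s ++ [m] <+: x ↔ s ++ [m] <+: y) := by
    intro x y hxy
    rw [SimpleGraph.deleteEdges_adj] at hxy
    obtain ⟨⟨a, rfl⟩ | ⟨a, rfl⟩, hne⟩ := hxy
    · rw [List.prefix_concat_iff]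
      refine ⟨Or.inr, fun h => h.resolve_left fun e => hne ?_⟩
      rw [← e, List.append_inj_left' e rfl]
      rfl
    · rw [List.prefix_concat_iff]
      refine ⟨fun h => h.resolve_left fun e => hne ?_, Or.inr⟩
      rw [← e, List.append_inj_left' e rfl, Sym2.eq_swap]
      rfl
  have inv : ∀ x y, ((prefixTree α).deleteEdges {s(s, s ++ [m])}).Walk x y →
      (s ++ [m] <+: x ↔ s ++ [m] <+: y) := by
    intro x y p
    induction p with
    | nil => rfl
    | cons hadj _ ih => exact (key _ _ hadj).trans ih
  obtain ⟨p⟩ := h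
  have := ((inv _ _ p).2 (List.prefix_refl _)).length_le
  simp at this

lemma prefixTree_isTree (α : Type) : (prefixTree α).IsTree := by
  refine ⟨prefixTree_connected α, ?_⟩
  rw [SimpleGraph.isAcyclic_iff_forall_adj_isBridge]
  rintro s t (⟨m, rfl⟩ | ⟨m, rfl⟩)
  · exact prefixTree_isBridge s m
  · rw [Sym2.eq_swap]
    exact prefixTree_isBridge t m

/-- The plays that are prefixes of `t` and whose last pebble is not moved again in `t`. -/
def activePlays {k : ℕ} {α : Type} (t : List (Fin k × α)) : Set (Play k α) :=
  {s | s.1 <+: t ∧ ∀ m ∈ t.drop s.1.length, m.1 ≠ (s.1.getLast s.2).1}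

lemma mem_activePlays_append {k : ℕ} {α : Type} (s : Play k α) (u : List (Fin k × α)) :
    s ∈ activePlays (s.1 ++ u) ↔ ∀ m ∈ u, m.1 ≠ (s.1.getLast s.2).1 := by
  simp [activePlays]

lemma mem_activePlays_self {k : ℕ} {α : Type} (s : Play k α) : s ∈ activePlays s.1 := by
  simp [activePlays]

lemma eq_of_mem_activePlays_of_prefix {k : ℕ} {α : Type} {t : List (Fin k × α)}
    {s s' : Play k α} (hs : s ∈ activePlays t) (hs' : s' ∈ activePlays t)
    (hp : (s.1.getLast s.2).1 = (s'.1.getLast s'.2).1) (hss : s.1 <+: s'.1) : s = s' := by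
  obtain ⟨s, hne⟩ := s
  obtain ⟨s', hne'⟩ := s'
  obtain ⟨u, rfl⟩ := hss
  obtain ⟨v, rfl⟩ := hs'.1
  rcases eq_or_ne u [] with rfl | hu
  · simp
  · dsimp only at hs hp
    rw [List.append_assoc] at hs
    have h := (mem_activePlays_append ⟨s, hne⟩ (u ++ v)).1 hs (u.getLast hu)
      (List.mem_append_left _ (List.getLast_mem hu))
    rw [List.getLast_append_of_ne_nil _ hu] at hp
    exact absurd hp.symm h

lemma injOn_lastPebble_activePlays {k : ℕ} {α : Type} (t : List (Fin k × α)) :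
    Set.InjOn (fun s : Play k α => (s.1.getLast s.2).1) (activePlays t) := by
  intro s hs s' hs' hp
  rcases List.prefix_or_prefix_of_prefix hs.1 hs'.1 with h | h
  · exact eq_of_mem_activePlays_of_prefix hs hs' hp h
  · exact (eq_of_mem_activePlays_of_prefix hs' hs hp.symm h).symm

lemma activePlays_finite {k : ℕ} {α : Type} (t : List (Fin k × α)) :
    (activePlays t).Finite :=
  Set.Finite.of_finite_image (Set.toFinite _) (injOn_lastPebble_activePlays t)

lemma ncard_activePlays_le {k : ℕ} {α : Type} (t : List (Fin k × α)) :
    (activePlays t).ncard ≤ k := by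
  rw [← (injOn_lastPebble_activePlays t).ncard_image]
  exact (Set.ncard_le_card _).trans_eq (Nat.card_fin k)

lemma induce_activePlays_connected {k : ℕ} {α : Type} (s : Play k α) :
    ((prefixTree (Fin k × α)).induce {t | s ∈ activePlays t}).Connected := by
  rw [SimpleGraph.connected_iff_exists_forall_reachable]
  refine ⟨⟨s.1, mem_activePlays_self s⟩, ?_⟩
  rintro ⟨t, ht⟩
  obtain ⟨u, rfl⟩ := ht.1
  induction u using List.reverseRecOn with
  | nil => simp
  | append_singleton u m ih =>
    have hu : s ∈ activePlays (s.1 ++ u) := by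
      rw [mem_activePlays_append]
      exact fun x hx => (mem_activePlays_append s _).1 ht x (List.mem_append_left _ hx)
    refine (ih hu).trans (SimpleGraph.Adj.reachable ?_)
    exact Or.inl ⟨m, (List.append_assoc _ _ _).symm⟩

/-- The tree decomposition of `T_k A` along the prefix tree of plays. -/
def pebblingTreeDecomp {σ : Signature} (A : Struct σ) (k : ℕ) : TreeDecomp (TStruct k A) where
  V := List (Fin k × A.carrier)
  G := prefixTree _
  isTree := prefixTree_isTree _
  bag := activePlays
  covers_elem s := ⟨s.1, mem_activePlays_self s⟩
  covers_rel := by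
    rintro R t ⟨⟨j, hj⟩, -⟩
    exact ⟨(t j).1, hj⟩
  bag_connected := induce_activePlays_connected

/-- T_k A admits a tree decomposition in which every bag has at most k
elements; consequently tw(T_k A) < k. -/
theorem treewidth_of_pebbling {σ : Signature} (A : Struct σ) (k : ℕ) (hk : 0 < k) :
    HasWidthUnder (TStruct k A) k :=
  ⟨pebblingTreeDecomp A k, fun t => ⟨activePlays_finite t, ncard_activePlays_le t⟩⟩
end

section
/- Let σ consist of two ternary relation symbols R_0 and R_1, let Z2 be the σ-structure with universe {0,1} where R_0 = {(i,j,k) : i⊕j⊕k = 0} and R_1 = {(i,j,k) : i⊕j⊕k = 1} (⊕ being addition mod 2), and let k be a positive integer. If A is a σ-structure with A →_k Z2, then there exists a pair of σ-structures A_0 and A_1 such that A_0 ≅_K A_1 (they are isomorphic in the co-Kleisli category of T_k), there is a homomorphism A → A_0, and there is a homomorphism A_1 → Z2. -/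
/-- The signature with two ternary relation symbols R₀, R₁. -/
inductive CFIRel : Type
  | r0
  | r1

abbrev cfiSig : Signature := ⟨CFIRel, fun _ => 3⟩

/-- The structure Z2 on the universe {0,1}, with R₀ the triples of parity 0 and R₁
the triples of parity 1. -/
def Z2 : Struct cfiSig where
  carrier := ZMod 2
  rel R t :=
    match R with
    | .r0 => t 0 + t 1 + t 2 = 0
    | .r1 => t 0 + t 1 + t 2 = 1

theorem Play.eps_Tmap {k : ℕ} {α β : Type} (f : α → β) (s : Play k α) :
    Play.eps (Tmap f s) = f (Play.eps s) := by
  simp [Play.eps, Tmap, List.getLast_map]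

theorem Play.Active.map {k : ℕ} {α β : Type} (f : α → β) {s t : Play k α}
    (h : Play.Active s t) : Play.Active (Tmap f s) (Tmap f t) := by
  refine ⟨h.1.map _, fun m hm => ?_⟩
  simp only [Tmap, List.length_map, ← List.map_drop, List.mem_map] at hm
  obtain ⟨m', hm', rfl⟩ := hm
  simpa [Tmap, List.getLast_map] using h.2 m' hm'

theorem Play.prefixAt_last {k : ℕ} {α : Type} (s : Play k α) :
    Play.prefixAt s (s.1.length - 1) = s := by
  have := List.length_pos_iff.2 s.2
  apply Subtype.ext
  exact List.take_of_length_le (by omega)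

theorem Play.eps_prefixAt {k : ℕ} {α : Type} (s : Play k α) (i : ℕ) (hi : i < s.1.length) :
    Play.eps (Play.prefixAt s i) = (s.1[i]).2 := by
  simp only [Play.eps, Play.prefixAt, List.getLast_eq_getElem, List.getElem_take,
    List.length_take]
  congr 2
  omega

theorem Play.eps_coext {k : ℕ} {α β : Type} (f : Play k α → β) (s : Play k α) :
    Play.eps (coext f s) = f s := by
  rw [coext, Play.eps_Tmap]
  congr 1
  simp only [Play.eps, delta, List.getLast_eq_getElem, List.getElem_ofFn, List.length_ofFn]
  exact Play.prefixAt_last s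

/-- A response function that preserves a projection of the last move preserves the projection
of whole plays. -/
theorem Tmap_coext {k : ℕ} {α β γ : Type} (f : Play k α → β) (p : α → γ) (q : β → γ)
    (hf : ∀ s, q (f s) = p (Play.eps s)) (s : Play k α) :
    Tmap q (coext f s) = Tmap p s := by
  apply Subtype.ext
  apply List.ext_getElem
  · simp [Tmap, coext, delta]
  · intro i h₁ h₂
    have hi : i < s.1.length := by simpa [Tmap] using h₂
    simp [Tmap, coext, delta, hf, Play.eps_prefixAt s i hi]

/-- The double cover of `A` in which the fibre coordinates of a triple in the relation `R` are
required to have sum `c R`. -/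
def doubleCover (A : Struct cfiSig) (c : CFIRel → ZMod 2) : Struct cfiSig where
  carrier := A.carrier × ZMod 2
  rel R t := A.rel R (fun i => (t i).1) ∧ (t 0).2 + (t 1).2 + (t 2).2 = c R

/-- The parity demanded by each relation symbol in `Z2`. -/
def CFIRel.parity : CFIRel → ZMod 2
  | .r0 => 0
  | .r1 => 1

theorem Z2_rel_iff (R : CFIRel) (t : Fin 3 → ZMod 2) :
    Z2.rel R t ↔ t 0 + t 1 + t 2 = R.parity := by
  cases R <;> rfl

/-- Shift the fibre coordinate of the last move of a play by the value of `f` on the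
projection of the play. -/
def fibreShift {k : ℕ} {α : Type} (f : Play k α → ZMod 2) (s : Play k (α × ZMod 2)) :
    α × ZMod 2 :=
  ((Play.eps s).1, (Play.eps s).2 + f (Tmap Prod.fst s))

theorem fibreShift_coext {k : ℕ} {α : Type} (f : Play k α → ZMod 2)
    (s : Play k (α × ZMod 2)) : fibreShift f (coext (fibreShift f) s) = Play.eps s := by
  have h : Tmap Prod.fst (coext (fibreShift f) s) = Tmap Prod.fst s :=
    Tmap_coext (fibreShift f) Prod.fst Prod.fst (fun _ => rfl) s
  rw [fibreShift, h, Play.eps_coext]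
  simp [fibreShift, add_assoc, CharTwo.add_self_eq_zero]

theorem isHom_fibreShift {k : ℕ} {A : Struct cfiSig} {f : Play k A.carrier → ZMod 2}
    (hf : IsHom (TStruct k A) Z2 f) {c d : CFIRel → ZMod 2}
    (hcd : ∀ R, c R + R.parity = d R) :
    IsHom (TStruct k (doubleCover A c)) (doubleCover A d) (fibreShift f) := by
  rintro R t ⟨⟨j, hj⟩, hA, hc⟩
  refine ⟨hA, ?_⟩
  have hA' : A.rel R fun i => Play.eps (Tmap Prod.fst (t i)) := by
    convert hA using 2 with i
    exact Play.eps_Tmap Prod.fst (t i)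
  have h := (Z2_rel_iff R _).1 <| hf R (fun i => Tmap Prod.fst (t i))
    ⟨⟨j, fun i => (hj i).map _⟩, hA'⟩
  rw [← hcd R, ← hc, ← h]
  exact (congrArg (· + _) (add_add_add_comm _ _ _ _)).trans (add_add_add_comm _ _ _ _)

/-- Cai–Fürer–Immerman construction: if A →_k Z2 then there are
structures A₀ ≅_K A₁ with a homomorphism A → A₀ and a homomorphism A₁ → Z2. -/
theorem cfi_construction (k : ℕ) (hk : 0 < k) (A : Struct cfiSig)
    (h : ∃ f, IsHom (TStruct k A) Z2 f) :
    ∃ A₀ A₁ : Struct cfiSig, CoKIso k A₀ A₁ ∧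
      (∃ h₀, IsHom A A₀ h₀) ∧ (∃ h₁, IsHom A₁ Z2 h₁) := by
  obtain ⟨f, hf⟩ := h
  refine ⟨doubleCover A 0, doubleCover A CFIRel.parity,
    ⟨fibreShift f, fibreShift f, isHom_fibreShift hf fun R => zero_add _,
      isHom_fibreShift hf fun R => CharTwo.add_self_eq_zero _,
      fibreShift_coext f, fibreShift_coext f⟩,
    ⟨fun a => (a, 0), fun R t ht => ⟨ht, by simp⟩⟩,
    ⟨Prod.snd, fun R t ht => (Z2_rel_iff R _).2 ht.2⟩⟩
end
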